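/- arXiv:0811.0281 — 2 statements merged into one kernel-verified Lean document; each statement's English description precedes it below -/
import Mathlib

section
/- Let p > 1, 0 ≤ j ≤ k integers, with c_i(j,k) defined as in the cited construction. Then ∑_{i=0}^{j} c_i(j,k)² = 1. -/
open Finset

noncomputable section

/-- 𝒪ₘ = 1 if m is odd, 0 otherwise. -/
def Opar (m : ℤ) : ℝ := if Odd m then 1 else 0

/-- ℰₘ = 1 if m is even, 0 otherwise. -/
def Epar (m : ℤ) : ℝ := if Even m then 1 else 0

/-- The coefficients cᵢ(j,k) of Proposition 6. -/
def c (p : ℝ) (j k i : ℕ) : ℝ :=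
  Real.sqrt (Nat.choose (k - j + i) i) *
    (∏ r ∈ Finset.range (k - j + 1),
      Real.sqrt (((r : ℝ) + 1 + Opar (r : ℤ) * (p - 2 + 2 * j))
        / ((k : ℝ) + 1 - r + Opar ((k : ℤ) - r) * (p - 2)))) *
    ∏ s ∈ Finset.Icc 1 i,
      ((-1 : ℝ) ^ (j - s) *
        Real.sqrt ((((j : ℝ) + 1 - s + Epar ((j : ℤ) - s) * (p - 2)) *
            ((k : ℝ) - j + 2 * s + Opar ((k : ℤ) + j - 1)))
          / (((k : ℝ) + 1 + s + Epar ((k : ℤ) + s - 1) * (p - 2)) *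
            ((k : ℝ) - j + 2 * s - Opar ((k : ℤ) + j - 1)))))

/-- a-factor -/
def aa (p : ℝ) (m : ℕ) : ℝ := (m : ℝ) + 1 + Epar (m : ℤ) * (p - 2)

/-- b-factor -/
def bb (p : ℝ) (m : ℕ) : ℝ := (m : ℝ) + 1 + Opar (m : ℤ) * (p - 2)

lemma Opar_even {m : ℤ} (h : Even m) : Opar m = 0 := by
  simp [Opar, h]

lemma Opar_odd {m : ℤ} (h : Odd m) : Opar m = 1 := by
  simp [Opar, h]

lemma Epar_even {m : ℤ} (h : Even m) : Epar m = 1 := by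
  simp [Epar, h]

lemma Epar_odd {m : ℤ} (h : Odd m) : Epar m = 0 := by
  simp [Epar, h]

lemma Epar_cases (m : ℤ) : (Epar m = 0 ∧ Opar m = 1) ∨ (Epar m = 1 ∧ Opar m = 0) := by
  rcases Int.even_or_odd m with h | h
  · exact Or.inr ⟨Epar_even h, Opar_even h⟩
  · exact Or.inl ⟨Epar_odd h, Opar_odd h⟩

lemma aa_pos {p : ℝ} (hp : 1 < p) (m : ℕ) : 0 < aa p m := by
  unfold aa
  have := Nat.cast_nonneg (α := ℝ) m
  rcases Epar_cases (m : ℤ) with ⟨h, _⟩ | ⟨h, _⟩ <;> rw [h] <;> linarith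

lemma bb_pos {p : ℝ} (hp : 1 < p) (m : ℕ) : 0 < bb p m := by
  unfold bb
  rcases Int.even_or_odd (m : ℤ) with h | h
  · rw [Opar_even h, zero_mul, add_zero]; positivity
  · have : (1 : ℝ) ≤ m := by
      have : Odd m := by exact_mod_cast h
      exact_mod_cast this.pos
    rw [Opar_odd h]; linarith

lemma aa_mul_bb (p : ℝ) (m : ℕ) : aa p m * bb p m = (m + 1) * (m + p - 1) := by
  unfold aa bb
  rcases Epar_cases (m : ℤ) with ⟨h, h'⟩ | ⟨h, h'⟩ <;> rw [h, h'] <;> ring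

def NN (p : ℝ) (d j : ℕ) : ℝ :=
  ∏ r ∈ Finset.range (d + 1), ((r : ℝ) + 1 + Opar (r : ℤ) * (p - 2 + 2 * j))

/-- denominator product -/
def DD (p : ℝ) (d j : ℕ) : ℝ :=
  ∏ r ∈ Finset.range (d + 1), bb p (j + r)

/-- ratio in i -/
def rho (p : ℝ) (d j i : ℕ) : ℝ :=
  ((d : ℝ) + i + 1) / (i + 1) *
    (aa p (j - (i + 1)) * ((d : ℝ) + 2 * (i + 1) + Epar d) /
      (bb p (j + d + i + 1) * ((d : ℝ) + 2 * (i + 1) - Epar d)))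

/-- squared coefficients -/
def TT (p : ℝ) (d j : ℕ) : ℕ → ℝ
  | 0 => NN p d j / DD p d j
  | i + 1 => TT p d j i * rho p d j i

/-- ratio in j -/
def sig (p : ℝ) (d j i : ℕ) : ℝ :=
  (2 * j + p + d + Opar d) * ((j + 1) * (j + p - 1)) /
    ((2 * j + p) * (aa p (j - i) * bb p (j + d + i + 1)))

lemma DD_pos {p : ℝ} (hp : 1 < p) (d j : ℕ) : 0 < DD p d j :=
  Finset.prod_pos fun _ _ => bb_pos hp _

lemma DD_step (p : ℝ) (d j : ℕ) : DD p d (j + 1) * bb p j = DD p d j * bb p (j + d + 1) := by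
  unfold DD
  have h1 := Finset.prod_range_succ (fun r => bb p (j + r)) (d + 1)
  have h2 := Finset.prod_range_succ' (fun r => bb p (j + r)) (d + 1)
  rw [h1] at h2
  rw [show j + d + 1 = j + (d + 1) by ring, h2]
  simp only [add_zero]
  congr 1
  refine Finset.prod_congr rfl fun r _ => ?_
  congr 1
  ring

lemma NN_step (p : ℝ) (d j : ℕ) :
    NN p d (j + 1) * (2 * j + p) = NN p d j * (2 * j + p + d + Opar d) := by
  induction d with
  | zero => simp [NN, Opar]
  | succ d ih =>
    have e : ∀ j, NN p (d + 1) j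
        = NN p d j * (((d + 1 : ℕ) : ℝ) + 1 + Opar ((d + 1 : ℕ) : ℤ) * (p - 2 + 2 * j)) := by
      intro j
      unfold NN
      rw [Finset.prod_range_succ]
    rw [e, e]
    rw [mul_right_comm, ih]
    rcases Int.even_or_odd (d : ℤ) with h | h
    · have h' : Odd ((d + 1 : ℕ) : ℤ) := by push_cast; exact h.add_one
      rw [Opar_even h, Opar_odd h']
      push_cast; ring
    · have h' : Even ((d + 1 : ℕ) : ℤ) := by push_cast; exact h.add_one
      rw [Opar_odd h, Opar_even h']
      push_cast; ring

lemma den_pos (d i : ℕ) : (0 : ℝ) < (d : ℝ) + 2 * (i + 1) - Epar d := by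
  rcases Epar_cases (d : ℤ) with ⟨h, _⟩ | ⟨h, _⟩ <;> rw [h]
  · rw [sub_zero]; positivity
  · have := Nat.cast_nonneg (α := ℝ) d
    have := Nat.cast_nonneg (α := ℝ) i
    linarith

lemma TT_step {p : ℝ} (hp : 1 < p) (d j i : ℕ) (hi : i ≤ j) :
    TT p d (j + 1) i = TT p d j i * sig p d j i := by
  have hj : (0 : ℝ) < 2 * j + p := by positivity
  induction i with
  | zero =>
    have h1 := DD_step p d j
    have h2 := NN_step p d j
    have h3 := aa_mul_bb p j
    have := DD_pos hp d j
    have := DD_pos hp d (j + 1)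
    have := aa_pos hp j
    have := bb_pos hp j
    have := bb_pos hp (j + d + 1)
    simp only [TT, sig, Nat.sub_zero, Nat.add_zero, ← h3]
    have e : NN p d (j + 1) = NN p d j * (2 * j + p + d + Opar d) / (2 * j + p) := by
      rw [eq_div_iff hj.ne', h2]
    have e2 : DD p d (j + 1) = DD p d j * bb p (j + d + 1) / bb p j := by
      rw [eq_div_iff (bb_pos hp j).ne', h1]
    rw [e, e2]
    field_simp
  | succ i ih =>
    simp only [TT]
    rw [ih (by omega)]
    have := aa_pos hp (j - i)
    have := aa_pos hp (j - (i + 1))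
    have := bb_pos hp (j + d + i + 1)
    have := bb_pos hp (j + d + i + 1 + 1)
    have := den_pos d i
    simp only [rho, sig]
    rw [show j + 1 - (i + 1) = j - i by omega,
      show j + 1 + d + i + 1 = j + d + i + 1 + 1 by ring,
      show j + d + (i + 1) + 1 = j + d + i + 1 + 1 by ring]
    field_simp

/-- certificate -/
def RR (p : ℝ) (d j n : ℕ) : ℝ :=
  if Odd (d : ℤ) then
    if Even ((j - n : ℕ) : ℤ) then
      - (d + n + 1) * (p + j - 1) / ((p + 2 * j) * (j + d + n + 2))
    else - (d + n + 1) * (j + 1) / ((p + 2 * j) * (p + j + d + n))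
  else
    if Even ((j - n : ℕ) : ℤ) then
      - (d + n + 1) * (p ^ 2 + (n + 2 * j + d - 1) * p + (2 * j * n + (d - 2) * j - d))
        / ((d + 2 * n + 1) * ((p + 2 * j) * (p + j + d + n)))
    else (d + n + 1) * (p ^ 2 + (2 * j - 3 - n) * p - (2 * j * n + 6 * j + d * j + d))
        / ((d + 2 * n + 1) * ((p + 2 * j) * (j + d + n + 2)))

lemma aa_even (p : ℝ) {m : ℕ} (h : Even m) : aa p m = m + p - 1 := by
  unfold aa; rw [Epar_even (by exact_mod_cast h)]; ring
lemma aa_odd (p : ℝ) {m : ℕ} (h : Odd m) : aa p m = m + 1 := by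
  unfold aa; rw [Epar_odd (by exact_mod_cast h)]; ring
lemma bb_even (p : ℝ) {m : ℕ} (h : Even m) : bb p m = m + 1 := by
  unfold bb; rw [Opar_even (by exact_mod_cast h)]; ring
lemma bb_odd (p : ℝ) {m : ℕ} (h : Odd m) : bb p m = m + p - 1 := by
  unfold bb; rw [Opar_odd (by exact_mod_cast h)]; ring

lemma cert_zero {p : ℝ} (hp : 1 < p) (d j : ℕ) : sig p d j 0 - 1 = RR p d j 0 := by
  have := Nat.cast_nonneg (α := ℝ) d
  have := Nat.cast_nonneg (α := ℝ) j
  have : (0 : ℝ) < j + p - 1 := by linarith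
  have : (0 : ℝ) < 2 * j + p := by linarith
  have : (0 : ℝ) < p + 2 * j := by linarith
  have : (0 : ℝ) < p + j + d := by linarith
  have : (0 : ℝ) < j + d + 1 + p - 1 := by linarith
  unfold sig RR
  rcases Nat.even_or_odd d with hd | hd <;> rcases Nat.even_or_odd j with hj | hj
  · have hb : Odd (j + d + 0 + 1) := by grind
    have hd' : ¬ Odd d := by grind
    rw [aa_even p (by simpa using hj), bb_odd p hb, Opar_even (by exact_mod_cast hd)]
    simp [hd', hj]
    field_simp
    ring
  · have hb : Even (j + d + 0 + 1) := by grind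
    have hd' : ¬ Odd d := by grind
    have hj' : ¬ Even j := by grind
    rw [aa_odd p (by simpa using hj), bb_even p hb, Opar_even (by exact_mod_cast hd)]
    simp [hd', hj']
    field_simp
    ring
  · have hb : Even (j + d + 0 + 1) := by grind
    rw [aa_even p (by simpa using hj), bb_even p hb, Opar_odd (by exact_mod_cast hd)]
    simp [hd, hj]
    field_simp
    ring
  · have hb : Odd (j + d + 0 + 1) := by grind
    have hj' : ¬ Even j := by grind
    rw [aa_odd p (by simpa using hj), bb_odd p hb, Opar_odd (by exact_mod_cast hd)]
    simp [hd, hj']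
    field_simp
    ring

lemma cert_succ {p : ℝ} (hp : 1 < p) (d n m : ℕ) :
    RR p d (n + 1 + m) n + rho p d (n + 1 + m) n * (sig p d (n + 1 + m) (n + 1) - 1)
      = rho p d (n + 1 + m) n * RR p d (n + 1 + m) (n + 1) := by
  have := Nat.cast_nonneg (α := ℝ) d
  have := Nat.cast_nonneg (α := ℝ) m
  have := Nat.cast_nonneg (α := ℝ) n
  have h1 : (m : ℝ) + p - 1 ≠ 0 := by linarith
  have h2 : (2 : ℝ) * (n + 1 + m) + p ≠ 0 := by linarith
  have h3 : p + (2 : ℝ) * (n + 1 + m) ≠ 0 := by linarith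
  have h4 : p + (n + 1 + m) + d + n ≠ 0 := by linarith
  have h5 : p + (n + 1 + m) + d + (n + 1) ≠ 0 := by linarith
  have h6 : (n : ℝ) + 1 + m + d + n + 1 + p - 1 ≠ 0 := by linarith
  have h7 : (n : ℝ) + 1 + m + d + (n + 1) + 1 + p - 1 ≠ 0 := by linarith
  have h8 : (d : ℝ) + 2 * (n + 1) - 1 ≠ 0 := by linarith
  have h9 : (d : ℝ) + 2 * n + 1 ≠ 0 := by linarith
  unfold sig RR rho
  rw [show n + 1 + m - n = m + 1 by omega, show n + 1 + m - (n + 1) = m by omega]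
  rcases Nat.even_or_odd d with hd | hd <;> rcases Nat.even_or_odd m with hm | hm
  · have hb : Even (n + 1 + m + d + n + 1) := by grind
    have hb' : Odd (n + 1 + m + d + (n + 1) + 1) := by grind
    have hd' : ¬ Odd (d : ℤ) := by simpa using hd
    have hm' : ¬ Even ((m + 1 : ℕ) : ℤ) := by rw [Int.even_coe_nat]; grind
    have hm'' : Even (m : ℤ) := by exact_mod_cast hm
    rw [aa_even p hm, bb_odd p hb', bb_even p hb, Opar_even (by exact_mod_cast hd),
      Epar_even (by exact_mod_cast hd)]
    rw [if_neg hd', if_neg hd', if_neg hm', if_pos hm'']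
    push_cast
    field_simp
    ring
  · have hb : Odd (n + 1 + m + d + n + 1) := by grind
    have hb' : Even (n + 1 + m + d + (n + 1) + 1) := by grind
    have hd' : ¬ Odd (d : ℤ) := by simpa using hd
    have hm' : Even ((m + 1 : ℕ) : ℤ) := by rw [Int.even_coe_nat]; grind
    have hm'' : ¬ Even (m : ℤ) := by rw [Int.even_coe_nat]; grind
    rw [aa_odd p hm, bb_even p hb', bb_odd p hb, Opar_even (by exact_mod_cast hd),
      Epar_even (by exact_mod_cast hd)]
    rw [if_neg hd', if_neg hd', if_pos hm', if_neg hm'']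
    push_cast
    field_simp
    ring
  · have hb : Odd (n + 1 + m + d + n + 1) := by grind
    have hb' : Even (n + 1 + m + d + (n + 1) + 1) := by grind
    have hd' : Odd (d : ℤ) := by exact_mod_cast hd
    have hm' : ¬ Even ((m + 1 : ℕ) : ℤ) := by rw [Int.even_coe_nat]; grind
    have hm'' : Even (m : ℤ) := by exact_mod_cast hm
    rw [aa_even p hm, bb_even p hb', bb_odd p hb, Opar_odd hd', Epar_odd hd']
    rw [if_pos hd', if_pos hd', if_neg hm', if_pos hm'']
    push_cast
    simp only [add_zero, sub_zero]
    field_simp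
    ring
  · have hb : Even (n + 1 + m + d + n + 1) := by grind
    have hb' : Odd (n + 1 + m + d + (n + 1) + 1) := by grind
    have hd' : Odd (d : ℤ) := by exact_mod_cast hd
    have hm' : Even ((m + 1 : ℕ) : ℤ) := by rw [Int.even_coe_nat]; grind
    have hm'' : ¬ Even (m : ℤ) := by rw [Int.even_coe_nat]; grind
    rw [aa_odd p hm, bb_odd p hb', bb_even p hb, Opar_odd hd', Epar_odd hd']
    rw [if_pos hd', if_pos hd', if_pos hm', if_neg hm'']
    push_cast
    simp only [add_zero, sub_zero]
    field_simp
    ring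

lemma cert_last {p : ℝ} (hp : 1 < p) (d j : ℕ) :
    RR p d j j + sig p d j j * rho p d (j + 1) j = 0 := by
  have := Nat.cast_nonneg (α := ℝ) d
  have := Nat.cast_nonneg (α := ℝ) j
  have h1 : p - 1 ≠ 0 := by linarith
  have h2 : (2 : ℝ) * j + p ≠ 0 := by linarith
  have h3 : p + (2 : ℝ) * j ≠ 0 := by linarith
  have h4 : p + j + d + j ≠ 0 := by linarith
  have h6 : (j : ℝ) + d + j + 1 + p - 1 ≠ 0 := by linarith
  have h7 : (j : ℝ) + 1 + d + j + 1 + p - 1 ≠ 0 := by linarith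
  have h8 : (d : ℝ) + 2 * (j + 1) - 1 ≠ 0 := by linarith
  have h9 : (d : ℝ) + 2 * j + 1 ≠ 0 := by linarith
  unfold sig RR rho
  rw [show j - j = 0 by omega, show j + 1 - (j + 1) = 0 by omega, aa_even p (by simp)]
  have h0 : Even ((0 : ℕ) : ℤ) := by simp
  rw [if_pos h0, if_pos h0]
  rcases Nat.even_or_odd d with hd | hd
  · have hb : Odd (j + d + j + 1) := by grind
    have hb' : Even (j + 1 + d + j + 1) := by grind
    have hd' : ¬ Odd (d : ℤ) := by simpa using hd
    rw [bb_even p hb', bb_odd p hb, Opar_even (by exact_mod_cast hd),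
      Epar_even (by exact_mod_cast hd), if_neg hd']
    push_cast
    simp only [add_zero, zero_add]
    field_simp
    ring
  · have hb : Even (j + d + j + 1) := by grind
    have hb' : Odd (j + 1 + d + j + 1) := by grind
    have hd' : Odd (d : ℤ) := by exact_mod_cast hd
    rw [bb_odd p hb', bb_even p hb, Opar_odd hd', Epar_odd hd', if_pos hd']
    push_cast
    simp only [add_zero, sub_zero, zero_add]
    field_simp
    ring

lemma partial_sum {p : ℝ} (hp : 1 < p) (d j n : ℕ) (hn : n ≤ j) :
    ∑ i ∈ Finset.range (n + 1), (TT p d (j + 1) i - TT p d j i) = RR p d j n * TT p d j n := by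
  induction n with
  | zero =>
    rw [Finset.sum_range_one, TT_step hp d j 0 hn, ← cert_zero hp d j]; ring
  | succ n ih =>
    rw [Finset.sum_range_succ, ih (by omega), TT_step hp d j (n + 1) hn]
    obtain ⟨m, rfl⟩ := Nat.exists_eq_add_of_le hn
    have h := cert_succ hp d n m
    simp only [TT]
    linear_combination (TT p d (n + 1 + m) n) * h

lemma NN_eq_DD (p : ℝ) (d : ℕ) : NN p d 0 = DD p d 0 := by
  unfold NN DD bb
  refine Finset.prod_congr rfl fun r _ => ?_
  simp

lemma TT_sum {p : ℝ} (hp : 1 < p) (d j : ℕ) :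
    ∑ i ∈ Finset.range (j + 1), TT p d j i = 1 := by
  induction j with
  | zero =>
    rw [Finset.sum_range_one]
    simp only [TT]
    rw [NN_eq_DD, div_self (DD_pos hp d 0).ne']
  | succ j ih =>
    have h := partial_sum hp d j j le_rfl
    rw [Finset.sum_sub_distrib, ih] at h
    rw [Finset.sum_range_succ]
    have h2 : TT p d (j + 1) (j + 1) = TT p d j j * (sig p d j j * rho p d (j + 1) j) := by
      rw [show TT p d (j + 1) (j + 1) = TT p d (j + 1) j * rho p d (j + 1) j from rfl,
        TT_step hp d j j le_rfl]
      ring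
    rw [h2]
    linear_combination h + TT p d j j * cert_last hp d j

lemma c_zero {p : ℝ} (hp : 1 < p) (d j : ℕ) : (c p j (j + d) 0) ^ 2 = TT p d j 0 := by
  unfold c
  simp only [TT, NN, DD]
  rw [show j + d - j = d by omega]
  simp only [add_zero, Nat.choose_zero_right, Nat.cast_one, Real.sqrt_one, one_mul]
  rw [show Finset.Icc 1 0 = (∅ : Finset ℕ) by simp, Finset.prod_empty, mul_one,
    ← Finset.prod_pow]
  rw [← Finset.prod_range_reflect (fun r => bb p (j + r)), ← Finset.prod_div_distrib]
  refine Finset.prod_congr rfl fun r hr => ?_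
  rw [Finset.mem_range] at hr
  obtain ⟨t, rfl⟩ : ∃ t, d = r + t := Nat.exists_eq_add_of_le (by omega)
  have e : (((j + (r + t) : ℕ) : ℝ) + 1 - r + Opar (((j + (r + t) : ℕ) : ℤ) - r) * (p - 2))
      = bb p (j + (r + t + 1 - 1 - r)) := by
    rw [show r + t + 1 - 1 - r = t by omega]
    unfold bb
    rw [show (((j + (r + t) : ℕ) : ℤ) - r) = ((j + t : ℕ) : ℤ) by push_cast; ring]
    push_cast; ring
  rw [e, Real.sq_sqrt]
  refine div_nonneg ?_ (bb_pos hp _).le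
  have := Nat.cast_nonneg (α := ℝ) j
  have := Nat.cast_nonneg (α := ℝ) r
  rcases Epar_cases (r : ℤ) with ⟨_, h⟩ | ⟨_, h⟩ <;> rw [h] <;> linarith

lemma c_succ {p : ℝ} (hp : 1 < p) (d j i : ℕ) (hi : i + 1 ≤ j) :
    (c p j (j + d) (i + 1)) ^ 2 = (c p j (j + d) i) ^ 2 * rho p d j i := by
  unfold c
  rw [show j + d - j = d by omega, Finset.prod_Icc_succ_top (by omega)]
  simp only [mul_pow]
  rw [← pow_mul, mul_comm (j - (i + 1)) 2, pow_mul, neg_one_sq, one_pow, one_mul]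
  rw [Real.sq_sqrt (Nat.cast_nonneg ((d + (i + 1)).choose (i + 1))),
    Real.sq_sqrt (Nat.cast_nonneg ((d + i).choose i))]
  have hch : ((d + (i + 1)).choose (i + 1) : ℝ) = (d + i).choose i * (((d : ℝ) + i + 1) / (i + 1)) := by
    have := Nat.add_one_mul_choose_eq (d + i) i
    have h : (((d + i : ℕ) : ℝ) + 1) * ((d + i).choose i : ℝ)
        = ((d + i + 1).choose (i + 1) : ℝ) * ((i : ℝ) + 1) := by exact_mod_cast this
    push_cast at h
    rw [← add_assoc]
    field_simp
    linarith
  have e1 : ((j : ℝ) + 1 - ((i + 1 : ℕ) : ℝ) + Epar ((j : ℤ) - ((i + 1 : ℕ) : ℤ)) * (p - 2))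
      = aa p (j - (i + 1)) := by
    obtain ⟨m, rfl⟩ := Nat.exists_eq_add_of_le hi
    rw [show i + 1 + m - (i + 1) = m by omega]
    unfold aa
    rw [show (((i + 1 + m : ℕ) : ℤ) - ((i + 1 : ℕ) : ℤ)) = m by push_cast; ring]
    push_cast; ring
  have e2 : (((j + d : ℕ) : ℝ) + 1 + ((i + 1 : ℕ) : ℝ)
      + Epar (((j + d : ℕ) : ℤ) + ((i + 1 : ℕ) : ℤ) - 1) * (p - 2)) = bb p (j + d + i + 1) := by
    unfold bb
    have : Epar (((j + d : ℕ) : ℤ) + ((i + 1 : ℕ) : ℤ) - 1) = Opar ((j + d + i + 1 : ℕ) : ℤ) := by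
      unfold Epar Opar
      congr 1
      push_cast
      apply propext
      grind
    rw [this]
    push_cast; ring
  have e3 : Opar (((j + d : ℕ) : ℤ) + (j : ℤ) - 1) = Epar d := by
    unfold Epar Opar
    congr 1
    push_cast
    apply propext
    grind
  rw [e1, e2, e3]
  have e4 : (((j + d : ℕ) : ℝ) - j + 2 * ((i + 1 : ℕ) : ℝ)) = (d : ℝ) + 2 * (i + 1) := by
    push_cast; ring
  rw [e4]
  have hE : 0 ≤ Epar d := by
    rcases Epar_cases (d : ℤ) with ⟨h, _⟩ | ⟨h, _⟩ <;> rw [h] <;> norm_num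
  have ha := aa_pos hp (j - (i + 1))
  have hb := bb_pos hp (j + d + i + 1)
  have hd := den_pos d i
  rw [Real.sq_sqrt (div_nonneg (mul_nonneg ha.le (by positivity)) (mul_pos hb hd).le), hch]
  unfold rho
  ring

lemma c_sq {p : ℝ} (hp : 1 < p) (d j i : ℕ) (hi : i ≤ j) :
    (c p j (j + d) i) ^ 2 = TT p d j i := by
  induction i with
  | zero => exact c_zero hp d j
  | succ i ih => rw [c_succ hp d j i hi, ih (by omega)]; rfl

theorem stmt6 (p : ℝ) (hp : 1 < p) (j k : ℕ) (hjk : j ≤ k) :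
    ∑ i ∈ Finset.range (j + 1), (c p j k i) ^ 2 = 1 := by
  obtain ⟨d, rfl⟩ := Nat.exists_eq_add_of_le hjk
  rw [← TT_sum hp d j]
  refine Finset.sum_congr rfl fun i hi => ?_
  exact c_sq hp d j i (by rw [Finset.mem_range] at hi; omega)
end
end

section
/- For ν ≥ 0 real and z > 0, K_ν(2z) = ∫_0^∞ exp(-z e^t) exp(-z e^{-t}) cosh(νt) dt, where K_ν is the modified Bessel function of the second kind. -/
open Real Filter

noncomputable section

/-- Modified Bessel function of the first kind,
    I_ν(x) = ∑ₙ (x/2)^{ν+2n}/(n! Γ(ν+n+1)). -/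
def besselI (ν x : ℝ) : ℝ :=
  ∑' n : ℕ, (x / 2) ^ (ν + 2 * (n : ℝ)) / ((Nat.factorial n : ℝ) * Real.Gamma (ν + n + 1))

/-- Modified Bessel function of the second kind:
    K_ν(x) = (π/(2 sin(νπ)))(I₋ν(x) - I_ν(x)) for non-integer ν,
    extended by continuity (limit over non-integer orders) to integer ν. -/
def besselK (ν x : ℝ) : ℝ :=
  limUnder (nhdsWithin ν {μ : ℝ | ∀ n : ℤ, μ ≠ (n : ℝ)})
    (fun μ => Real.pi / (2 * Real.sin (μ * Real.pi)) * (besselI (-μ) x - besselI μ x))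

/-- Entire part of the series. -/
def bf (ν y : ℝ) : ℝ := ∑' k : ℕ, y ^ k / ((Nat.factorial k : ℝ) * Real.Gamma (ν + k + 1))

/-- Non-integrality. -/
def NI (ν : ℝ) : Prop := ∀ n : ℤ, ν ≠ (n : ℝ)

/-- The integrand. -/
def gi (ν y t : ℝ) : ℝ := Real.exp (ν * t - Real.exp t - y * Real.exp (-t))

/-- The integral. -/
def bG (ν y : ℝ) : ℝ := ∫ t : ℝ, gi ν y t

lemma NI.add_int {ν : ℝ} (h : NI ν) (m : ℤ) : NI (ν + m) := by
  intro n hn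
  apply h (n - m)
  push_cast
  linarith

lemma NI.neg {ν : ℝ} (h : NI ν) : NI (-ν) := by
  intro n hn
  apply h (-n)
  push_cast
  linarith

lemma NI.gamma_ne {ν : ℝ} (h : NI ν) (k : ℕ) : Real.Gamma (ν + k) ≠ 0 := by
  apply Real.Gamma_ne_zero
  intro m hm
  apply h (-m - k)
  push_cast
  linarith

lemma NI.gamma_ne' {ν : ℝ} (h : NI ν) (k : ℕ) : Real.Gamma (ν + k + 1) ≠ 0 := by
  have := h.gamma_ne (k + 1)
  push_cast at this
  rwa [← add_assoc] at this

lemma NI.ne {ν : ℝ} (h : NI ν) (k : ℕ) : ν + k ≠ 0 := by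
  intro hm
  apply h (-k)
  push_cast
  linarith

lemma NI.gamma_succ {ν : ℝ} (h : NI ν) (k : ℕ) :
    Real.Gamma (ν + k + 1) = (ν + k) * Real.Gamma (ν + k) := Real.Gamma_add_one (h.ne k)

lemma bf_summable {ν : ℝ} (h : NI ν) (y : ℝ) :
    Summable (fun k : ℕ => y ^ k / ((Nat.factorial k : ℝ) * Real.Gamma (ν + k + 1))) := by
  rcases eq_or_ne y 0 with rfl | hy
  · apply summable_of_ne_finset_zero (s := {0})
    intro b hb
    simp at hb
    simp [hb]
  apply summable_of_ratio_test_tendsto_lt_one (l := 0) one_pos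
  · filter_upwards with k
    have := h.gamma_ne' k
    positivity
  · have h1 : Tendsto (fun k : ℕ => |y| * (((k : ℝ) + 1)⁻¹ * |ν + 1 + k|⁻¹)) atTop (nhds (|y| * (0 * 0))) := by
      apply Tendsto.const_mul
      apply Tendsto.mul
      · apply Filter.Tendsto.inv_tendsto_atTop
        exact tendsto_atTop_add_const_right _ _ tendsto_natCast_atTop_atTop
      · apply Filter.Tendsto.inv_tendsto_atTop
        apply tendsto_abs_atTop_atTop.comp
        exact tendsto_atTop_add_const_left _ _ tendsto_natCast_atTop_atTop
    simp only [mul_zero] at h1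
    refine h1.congr ?_
    intro k
    have h2 := h.gamma_ne' k
    have h3 := h.gamma_succ (k + 1)
    have h4 := h.ne (k + 1)
    push_cast at h3 h4
    rw [Nat.factorial_succ]
    push_cast
    rw [h3]
    rw [show ν + ((k : ℝ) + 1) = ν + k + 1 by ring] at *
    rw [show ν + 1 + (k : ℝ) = ν + k + 1 by ring]
    have h5 : (0:ℝ) < k + 1 := by positivity
    simp only [norm_div, norm_mul, norm_pow, Real.norm_eq_abs, abs_of_pos h5, Nat.abs_cast]
    have h6 : |ν + k + 1| ≠ 0 := abs_ne_zero.mpr h4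
    have h7 : |Real.Gamma (ν + k + 1)| ≠ 0 := abs_ne_zero.mpr h2
    have h8 : |y| ≠ 0 := abs_ne_zero.mpr hy
    have h9 : (k.factorial : ℝ) ≠ 0 := by positivity
    field_simp
    ring

lemma bf_rec {μ : ℝ} (h : NI μ) (y : ℝ) : bf (μ - 1) y = μ * bf μ y + y * bf (μ + 1) y := by
  have hm := h.add_int (-1)
  have hp := h.add_int 1
  push_cast at hm hp
  have s0 := bf_summable h y
  have s1 := bf_summable hp y
  have s2 : Summable (fun k : ℕ => (k : ℝ) * (y ^ k / ((Nat.factorial k : ℝ) * Real.Gamma (μ + k + 1)))) := by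
    rw [← summable_nat_add_iff 1]
    refine (s1.mul_left y).congr ?_
    intro k
    rw [Nat.factorial_succ]
    push_cast
    rw [show μ + ((k : ℝ) + 1) + 1 = μ + 1 + k + 1 by ring]
    have h5 : (k:ℝ) + 1 ≠ 0 := by positivity
    have := hp.gamma_ne' k
    field_simp
    ring
  have e2 : ∑' k : ℕ, (k : ℝ) * (y ^ k / ((Nat.factorial k : ℝ) * Real.Gamma (μ + k + 1))) = y * bf (μ + 1) y := by
    rw [s2.tsum_eq_zero_add, bf, ← tsum_mul_left]
    simp only [Nat.cast_zero, zero_mul, zero_add]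
    apply tsum_congr
    intro k
    rw [Nat.factorial_succ]
    push_cast
    rw [show μ + ((k : ℝ) + 1) + 1 = μ + 1 + k + 1 by ring]
    have h5 : (k:ℝ) + 1 ≠ 0 := by positivity
    have := hp.gamma_ne' k
    field_simp
    ring
  rw [← e2, bf, bf, ← tsum_mul_left, ← (s0.mul_left μ).tsum_add s2]
  apply tsum_congr
  intro k
  rw [show μ - 1 + (k : ℝ) + 1 = μ + k by ring, h.gamma_succ k]
  have := h.gamma_ne k
  have := h.ne k
  field_simp

lemma bf_deriv {μ : ℝ} (h : NI μ) (y : ℝ) : HasDerivAt (bf μ) (bf (μ + 1) y) y := by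
  have hp := h.add_int 1
  push_cast at hp
  have e : ∀ k : ℕ, ∀ x : ℝ, ((k + 1 : ℕ) : ℝ) * x ^ k /
      ((Nat.factorial (k + 1) : ℝ) * Real.Gamma (μ + (k + 1 : ℕ) + 1))
      = x ^ k / ((Nat.factorial k : ℝ) * Real.Gamma (μ + 1 + k + 1)) := by
    intro k x
    rw [Nat.factorial_succ]
    push_cast
    rw [show μ + ((k : ℝ) + 1) + 1 = μ + 1 + k + 1 by ring]
    have h5 : (k:ℝ) + 1 ≠ 0 := by positivity
    have := hp.gamma_ne' k
    field_simp
  set R := |y| + 1 with hR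
  have key : HasDerivAt (fun x => ∑' k : ℕ, x ^ k / ((Nat.factorial k : ℝ) * Real.Gamma (μ + k + 1)))
      (∑' k : ℕ, (k : ℝ) * y ^ (k - 1) / ((Nat.factorial k : ℝ) * Real.Gamma (μ + k + 1))) y := by
    have hy : y ∈ Metric.ball (0 : ℝ) R := by
      simp [hR]
    apply hasDerivAt_tsum_of_isPreconnected
      (u := fun k : ℕ => ‖(k : ℝ) * R ^ (k - 1) / ((Nat.factorial k : ℝ) * Real.Gamma (μ + k + 1))‖)
      (t := Metric.ball (0 : ℝ) R) (y₀ := y) (g' := fun k x => (k : ℝ) * x ^ (k - 1) / ((Nat.factorial k : ℝ) * Real.Gamma (μ + k + 1)))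
    · rw [← summable_nat_add_iff 1]
      simp only [Nat.add_sub_cancel, e]
      exact (bf_summable hp R).norm
    · exact Metric.isOpen_ball
    · exact (convex_ball _ _).isPreconnected
    · intro n x _
      exact (hasDerivAt_pow n x).div_const _
    · intro n x hx
      rw [norm_div, norm_div, norm_mul (n : ℝ) (x ^ (n - 1)), norm_mul (n : ℝ) (R ^ (n - 1)), norm_pow, norm_pow]
      have : ‖x‖ ≤ ‖R‖ := by
        rw [mem_ball_zero_iff] at hx
        exact hx.le.trans (le_abs_self R)
      gcongr
    · exact hy
    · exact bf_summable h y
    · exact hy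
  have e3 : (∑' k : ℕ, (k : ℝ) * y ^ (k - 1) / ((Nat.factorial k : ℝ) * Real.Gamma (μ + k + 1))) = bf (μ + 1) y := by
    rw [Summable.tsum_eq_zero_add]
    · simp only [Nat.add_sub_cancel, e]
      simp [bf]
    · rw [← summable_nat_add_iff 1]
      simp only [Nat.add_sub_cancel, e]
      exact bf_summable hp y
  rw [e3] at key
  exact key

lemma ypow_bf_deriv {μ : ℝ} (h : NI μ) {y : ℝ} (hy : 0 < y) :
    HasDerivAt (fun x => x ^ μ * bf μ x) (y ^ (μ - 1) * bf (μ - 1) y) y := by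
  have := (Real.hasDerivAt_rpow_const (p := μ) (Or.inl hy.ne')).mul (bf_deriv h y)
  refine this.congr_deriv (Eq.symm ?_)
  rw [bf_rec h y, Real.rpow_sub_one hy.ne']
  field_simp

lemma bf_zero (μ : ℝ) : bf μ 0 = (Real.Gamma (μ + 1))⁻¹ := by
  rw [bf, tsum_eq_single 0]
  · simp
  · intro k hk
    simp [hk]

open MeasureTheory in
lemma gi_zero (ν : ℝ) (t : ℝ) : gi ν 0 t = |Real.exp t| • (Real.exp (-Real.exp t) * (Real.exp t) ^ (ν - 1)) := by
  rw [abs_of_pos (Real.exp_pos t), ← Real.exp_mul, smul_eq_mul, ← Real.exp_add, ← Real.exp_add, gi]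
  congr 1
  ring

open MeasureTheory in
lemma gi_zero_integrable {ν : ℝ} (h : 0 < ν) : Integrable (gi ν 0) := by
  have h1 := Real.GammaIntegral_convergent h
  rw [← Real.range_exp, ← Set.image_univ, integrableOn_image_iff_integrableOn_abs_deriv_smul
    MeasurableSet.univ (fun x _ => (Real.hasDerivAt_exp x).hasDerivWithinAt) Real.exp_injective.injOn,
    integrableOn_univ] at h1
  exact h1.congr (Eventually.of_forall fun t => (gi_zero ν t).symm)

open MeasureTheory in
lemma bG_zero {ν : ℝ} (h : 0 < ν) : bG ν 0 = Real.Gamma ν := by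
  rw [Real.Gamma_eq_integral h, ← Real.range_exp, ← Set.image_univ,
    integral_image_eq_integral_abs_deriv_smul
    MeasurableSet.univ (fun x _ => (Real.hasDerivAt_exp x).hasDerivWithinAt) Real.exp_injective.injOn,
    setIntegral_univ, bG]
  exact integral_congr_ae (Eventually.of_forall fun t => gi_zero ν t)

lemma gi_cont (ν y : ℝ) : Continuous (gi ν y) := by
  unfold gi
  fun_prop

lemma gi_pos (ν y t : ℝ) : 0 < gi ν y t := Real.exp_pos _

lemma gi_anti (ν t : ℝ) {x y : ℝ} (h : x ≤ y) : gi ν y t ≤ gi ν x t := by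
  unfold gi
  gcongr

open MeasureTheory in
lemma gi_integrable (ν : ℝ) {y : ℝ} (hy : 0 < y) : Integrable (gi ν y) := by
  obtain ⟨N, hN⟩ := exists_nat_gt (-ν)
  have h1 := (gi_zero_integrable (ν := ν + N) (by linarith)).const_mul ((N.factorial : ℝ) / y ^ N)
  refine h1.mono' (gi_cont ν y).aestronglyMeasurable (Eventually.of_forall fun t => ?_)
  rw [Real.norm_eq_abs, abs_of_pos (gi_pos _ _ _)]
  have h2 := Real.pow_div_factorial_le_exp (y * Real.exp (-t)) (by positivity) N
  have h3 : gi ν y t = gi (ν + N) 0 t * (Real.exp (-t)) ^ N * (Real.exp (y * Real.exp (-t)))⁻¹ := by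
    unfold gi
    rw [← Real.exp_nat_mul, ← Real.exp_neg, ← Real.exp_add, ← Real.exp_add]
    congr 1
    ring
  rw [h3]
  have h4 : (Real.exp (y * Real.exp (-t)))⁻¹ ≤ ((y * Real.exp (-t)) ^ N / (N.factorial : ℝ))⁻¹ := by
    gcongr
  calc _ ≤ gi (ν + N) 0 t * (Real.exp (-t)) ^ N * ((y * Real.exp (-t)) ^ N / (N.factorial : ℝ))⁻¹ := by
        have := (gi_pos (ν + N) 0 t).le
        gcongr
    _ = _ := by
        have := Real.exp_pos (-t)
        rw [mul_pow]
        field_simp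

open MeasureTheory in
lemma bG_deriv (ν : ℝ) {y : ℝ} (hy : 0 < y) : HasDerivAt (bG ν) (-bG (ν - 1) y) y := by
  have := hasDerivAt_integral_of_dominated_loc_of_deriv_le (μ := volume) (F := gi ν)
    (F' := fun x t => - gi (ν - 1) x t) (x₀ := y) (s := Set.Ioi (y / 2)) (bound := gi (ν - 1) (y / 2))
    (Ioi_mem_nhds (by linarith)) (Eventually.of_forall fun x => (gi_cont ν x).aestronglyMeasurable)
    (gi_integrable ν hy) (gi_cont _ _).neg.aestronglyMeasurable
    (Eventually.of_forall fun t x hx => by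
      rw [norm_neg, Real.norm_eq_abs, abs_of_pos (gi_pos _ _ _)]
      exact gi_anti _ _ (le_of_lt hx)) (gi_integrable _ (by linarith))
    (Eventually.of_forall fun t x hx => by
      have h1 : HasDerivAt (fun x : ℝ => ν * t - Real.exp t - x * Real.exp (-t)) (-(1 * Real.exp (-t))) x :=
        ((hasDerivAt_id x).mul_const _).const_sub _
      have h2 := h1.exp
      unfold gi
      refine h2.congr_deriv (Eq.symm ?_)
      rw [one_mul, mul_neg, ← Real.exp_add]
      congr 2
      ring)
  have h2 := this.2
  rw [integral_neg] at h2
  exact h2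

open MeasureTheory in
lemma bG_contOn {ν : ℝ} (h : 0 < ν) : ContinuousOn (bG ν) (Set.Ici 0) := by
  apply continuousOn_of_dominated (bound := gi ν 0)
  · intro x _
    exact (gi_cont ν x).aestronglyMeasurable
  · intro x hx
    refine Eventually.of_forall fun t => ?_
    rw [Real.norm_eq_abs, abs_of_pos (gi_pos _ _ _)]
    exact gi_anti _ _ hx
  · exact gi_zero_integrable h
  · refine Eventually.of_forall fun t => ?_
    unfold gi
    fun_prop

open MeasureTheory in
lemma bG_symm (ν : ℝ) {y : ℝ} (hy : 0 < y) : bG ν y = y ^ ν * bG (-ν) y := by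
  unfold bG
  rw [← integral_sub_left_eq_self (gi ν y) volume (Real.log y), ← integral_const_mul]
  congr 1
  ext t
  unfold gi
  rw [Real.rpow_def_of_pos hy, ← Real.exp_add]
  congr 1
  rw [Real.exp_sub, neg_sub, Real.exp_sub, Real.exp_log hy, Real.exp_neg]
  field_simp
  ring

/-- The series side. -/
def bR (ν y : ℝ) : ℝ := Real.pi / Real.sin (Real.pi * ν) * (bf (-ν) y - y ^ ν * bf ν y)

lemma bR_deriv {ν : ℝ} (h : NI ν) {y : ℝ} (hy : 0 < y) : HasDerivAt (bR ν) (-bR (ν - 1) y) y := by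
  have h1 := ((bf_deriv h.neg y).sub (ypow_bf_deriv h hy)).const_mul (Real.pi / Real.sin (Real.pi * ν))
  refine h1.congr_deriv (Eq.symm ?_)
  unfold bR
  rw [show Real.pi * (ν - 1) = Real.pi * ν - Real.pi by ring, Real.sin_sub_pi,
    show -(ν - 1) = -ν + 1 by ring, div_neg]
  ring

lemma bR_symm (ν : ℝ) {y : ℝ} (hy : 0 < y) : bR ν y = y ^ ν * bR (-ν) y := by
  unfold bR
  rw [neg_neg, mul_neg, Real.sin_neg, Real.rpow_neg hy.le, div_neg]
  have := Real.rpow_pos_of_pos hy ν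
  field_simp
  ring

lemma bf_cont {ν : ℝ} (h : NI ν) : Continuous (bf ν) :=
  continuous_iff_continuousAt.mpr fun y => (bf_deriv h y).continuousAt

lemma bR_cont {ν : ℝ} (h : NI ν) (hν : 0 < ν) : Continuous (bR ν) := by
  unfold bR
  have := bf_cont h
  have := bf_cont h.neg
  have := Real.continuous_rpow_const hν.le
  fun_prop

lemma bR_zero {ν : ℝ} (h : NI ν) (hν : 0 < ν) : bR ν 0 = Real.Gamma ν := by
  unfold bR
  rw [Real.zero_rpow hν.ne', zero_mul, sub_zero, bf_zero, ← Real.Gamma_mul_Gamma_one_sub,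
    neg_add_eq_sub]
  have := h.neg.gamma_ne 1
  push_cast at this
  rw [neg_add_eq_sub] at this
  field_simp

/-- Difference. -/
def bD (ν y : ℝ) : ℝ := bG ν y - bR ν y

lemma bD_deriv {ν : ℝ} (h : NI ν) {y : ℝ} (hy : 0 < y) : HasDerivAt (bD ν) (-bD (ν - 1) y) y := by
  have h1 := (bG_deriv ν hy).sub (bR_deriv h hy)
  refine h1.congr_deriv (Eq.symm ?_)
  unfold bD
  ring

lemma bD_symm (ν : ℝ) {y : ℝ} (hy : 0 < y) : bD ν y = y ^ ν * bD (-ν) y := by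
  unfold bD
  rw [bG_symm ν hy, bR_symm ν hy]
  ring

lemma bD_base {ν : ℝ} (h0 : 0 < ν) (h1 : ν < 1) {y : ℝ} (hy : 0 < y) : bD ν y = 0 := by
  have hn : NI ν := by
    rintro n rfl
    have a : 0 < n := by exact_mod_cast h0
    have b : n < 1 := by exact_mod_cast h1
    omega
  have hn' : NI (1 - ν) := by
    have := hn.neg.add_int 1
    push_cast at this
    rwa [neg_add_eq_sub] at this
  have h1' : 0 < 1 - ν := by linarith
  have dD : ∀ x : ℝ, 0 < x → HasDerivAt (bD ν) (-(x ^ (ν - 1) * bD (1 - ν) x)) x := by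
    intro x hx
    have := bD_deriv hn hx
    rwa [bD_symm _ hx, neg_sub] at this
  have dE : ∀ x : ℝ, 0 < x → HasDerivAt (bD (1 - ν)) (-(x ^ (-ν) * bD ν x)) x := by
    intro x hx
    have := bD_deriv hn' hx
    rwa [bD_symm _ hx, show 1 - ν - 1 = -ν by ring, neg_neg] at this
  have dH : ∀ x : ℝ, 0 < x → HasDerivAt (fun x : ℝ => x ^ ν / ν + x ^ (1 - ν) / (1 - ν))
      (x ^ (ν - 1) + x ^ (-ν)) x := by
    intro x hx
    have a := (Real.hasDerivAt_rpow_const (p := ν) (Or.inl hx.ne')).div_const ν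
    have b := (Real.hasDerivAt_rpow_const (p := 1 - ν) (Or.inl hx.ne')).div_const (1 - ν)
    refine (a.add b).congr_deriv (Eq.symm ?_)
    rw [show 1 - ν - 1 = -ν by ring]
    field_simp
  have dφ : ∀ x : ℝ, 0 < x → HasDerivAt
      (fun x : ℝ => ((bD ν x) ^ 2 + (bD (1 - ν) x) ^ 2) * Real.exp (-(x ^ ν / ν + x ^ (1 - ν) / (1 - ν))))
      (-((x ^ (ν - 1) + x ^ (-ν)) * (bD ν x + bD (1 - ν) x) ^ 2 *
        Real.exp (-(x ^ ν / ν + x ^ (1 - ν) / (1 - ν))))) x := by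
    intro x hx
    have := ((((dD x hx).pow 2).add ((dE x hx).pow 2)).mul (dH x hx).neg.exp)
    refine this.congr_deriv (Eq.symm ?_)
    simp
    ring
  have cD : ContinuousOn (bD ν) (Set.Ici 0) := (bG_contOn h0).sub (bR_cont hn h0).continuousOn
  have cE : ContinuousOn (bD (1 - ν)) (Set.Ici 0) := (bG_contOn h1').sub (bR_cont hn' h1').continuousOn
  have cH : Continuous (fun x : ℝ => x ^ ν / ν + x ^ (1 - ν) / (1 - ν)) :=
    ((Real.continuous_rpow_const h0.le).div_const _).add ((Real.continuous_rpow_const h1'.le).div_const _)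
  have anti : AntitoneOn (fun x : ℝ => ((bD ν x) ^ 2 + (bD (1 - ν) x) ^ 2) *
      Real.exp (-(x ^ ν / ν + x ^ (1 - ν) / (1 - ν)))) (Set.Ici 0) := antitoneOn_of_deriv_nonpos (convex_Ici (0:ℝ))
    (((cD.pow 2).add (cE.pow 2)).mul (Real.continuous_exp.comp cH.neg).continuousOn)
    (by
      intro x hx
      rw [interior_Ici] at hx
      exact (dφ x hx).differentiableAt.differentiableWithinAt)
    (by
      intro x hx
      rw [interior_Ici] at hx
      have hx' : 0 < x := hx
      have e := (dφ x hx).deriv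
      refine le_trans (le_of_eq e) ?_
      rw [neg_nonpos]
      positivity)
  have z0 : bD ν 0 = 0 := by rw [bD, bG_zero h0, bR_zero hn h0, sub_self]
  have z1 : bD (1 - ν) 0 = 0 := by rw [bD, bG_zero h1', bR_zero hn' h1', sub_self]
  have key := anti (Set.mem_Ici.mpr le_rfl) (Set.mem_Ici.mpr hy.le) hy.le
  simp only [z0, z1] at key
  norm_num at key
  by_contra hne
  have : 0 < bD ν y ^ 2 := by positivity
  exact absurd key (not_le.mpr (by positivity))

lemma bD_down {ν : ℝ} (h : NI ν) (hz : ∀ y : ℝ, 0 < y → bD ν y = 0) :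
    ∀ y : ℝ, 0 < y → bD (ν - 1) y = 0 := by
  intro y hy
  have h1 := bD_deriv h hy
  have h2 : HasDerivAt (bD ν) 0 y := by
    apply (hasDerivAt_const y (0:ℝ)).congr_of_eventuallyEq
    filter_upwards [Ioi_mem_nhds hy] with x hx
    exact hz x hx
  have := h1.unique h2
  linarith

lemma bD_base_sub {ν : ℝ} (h : NI ν) (h0 : 0 < ν) (h1 : ν < 1) (n : ℕ) :
    ∀ y : ℝ, 0 < y → bD (ν - n) y = 0 := by
  induction n with
  | zero =>
    intro y hy
    simpa using bD_base h0 h1 hy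
  | succ k ih =>
    have hk := h.add_int (-k)
    push_cast at hk
    rw [← sub_eq_add_neg] at hk
    have := bD_down hk ih
    push_cast
    rwa [← sub_sub]

lemma bD_neg {ν : ℝ} (h : NI ν) (hν : ν < 0) : ∀ y : ℝ, 0 < y → bD ν y = 0 := by
  have hf := h.add_int (-⌊ν⌋)
  push_cast at hf
  rw [← sub_eq_add_neg] at hf
  have h1 := Int.sub_floor_div_mul_nonneg ν one_pos
  have a : (⌊ν⌋ : ℝ) ≤ ν := Int.floor_le ν
  have b : ν < ⌊ν⌋ + 1 := Int.lt_floor_add_one ν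
  have c : ⌊ν⌋ ≠ ν := fun e => h _ e.symm
  have d : (⌊ν⌋ : ℝ) < ν := lt_of_le_of_ne a c
  have e : ⌊ν⌋ ≤ 0 := by
    have : (⌊ν⌋ : ℝ) < 0 := by linarith
    have : ⌊ν⌋ < 0 := by exact_mod_cast this
    omega
  obtain ⟨n, hn⟩ := Int.eq_ofNat_of_zero_le (a := -⌊ν⌋) (by omega)
  have hn' : (⌊ν⌋ : ℝ) = -(n : ℝ) := by
    have : ⌊ν⌋ = -(n : ℤ) := by omega
    rw [this]
    push_cast
    rfl
  have := bD_base_sub hf (by linarith) (by linarith) n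
  rwa [show ν - (⌊ν⌋ : ℝ) - n = ν by rw [hn']; ring] at this

lemma bD_all {ν : ℝ} (h : NI ν) {y : ℝ} (hy : 0 < y) : bD ν y = 0 := by
  rcases lt_trichotomy ν 0 with h0 | h0 | h0
  · exact bD_neg h h0 y hy
  · exact absurd h0 (by simpa using h 0)
  · rw [bD_symm _ hy, bD_neg h.neg (by linarith) y hy, mul_zero]

lemma besselI_eq (ν : ℝ) {z : ℝ} (hz : 0 < z) : besselI ν (2 * z) = z ^ ν * bf ν (z ^ 2) := by
  unfold besselI bf
  rw [← tsum_mul_left]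
  apply tsum_congr
  intro n
  rw [mul_div_cancel_left₀ z two_ne_zero, ← pow_mul,
    show ν + 2 * (n : ℝ) = ν + ((2 * n : ℕ) : ℝ) by push_cast; ring, Real.rpow_add_natCast hz.ne', mul_div_assoc]

/-- Two-sided integrand. -/
def gj (z ν t : ℝ) : ℝ := Real.exp (ν * t) * (Real.exp (-z * Real.exp t) * Real.exp (-z * Real.exp (-t)))

lemma gj_eq {z : ℝ} (hz : 0 < z) (ν t : ℝ) : gj z ν t = z ^ (-ν) * gi ν (z ^ 2) (t + Real.log z) := by
  unfold gi gj
  rw [Real.rpow_def_of_pos hz, ← Real.exp_add, ← Real.exp_add, ← Real.exp_add]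
  congr 1
  rw [Real.exp_add, neg_add, Real.exp_add, Real.exp_neg (Real.log z), Real.exp_log hz]
  field_simp
  ring

open MeasureTheory in
lemma gj_integrable {z : ℝ} (hz : 0 < z) (ν : ℝ) : Integrable (gj z ν) := by
  have h := ((gi_integrable ν (y := z ^ 2) (by positivity)).comp_add_right (Real.log z)).const_mul (z ^ (-ν))
  exact h.congr (Eventually.of_forall fun t => (gj_eq hz ν t).symm)

open MeasureTheory in
lemma gj_integral {z : ℝ} (hz : 0 < z) (ν : ℝ) : ∫ t, gj z ν t = z ^ (-ν) * bG ν (z ^ 2) := by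
  simp_rw [gj_eq hz]
  rw [integral_const_mul, integral_add_right_eq_self (gi ν (z ^ 2)), bG]

open MeasureTheory in
lemma gj_fold {z : ℝ} (hz : 0 < z) (ν : ℝ) : ∫ t in Set.Ioi (0 : ℝ),
    Real.exp (-z * Real.exp t) * Real.exp (-z * Real.exp (-t)) * Real.cosh (ν * t)
    = (1 / 2) * ∫ t, gj z ν t := by
  have hi := gj_integrable hz ν
  rw [← intervalIntegral.integral_Iic_add_Ioi (b := 0) hi.integrableOn hi.integrableOn]
  have h2 := integral_comp_neg_Ioi 0 (gj z ν)
  rw [neg_zero] at h2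
  rw [← h2, ← integral_add hi.comp_neg.integrableOn hi.integrableOn, ← integral_const_mul]
  congr 1
  ext t
  unfold gj
  rw [Real.cosh_eq, neg_neg, mul_neg]
  ring

open MeasureTheory in
lemma gj_cont {z : ℝ} (hz : 0 < z) (ν : ℝ) : ContinuousAt (fun μ => ∫ t, gj z μ t) ν := by
  apply continuousAt_of_dominated (bound := fun t => gj z (ν - 1) t + gj z (ν + 1) t)
  · refine Eventually.of_forall fun μ => ?_
    exact (gj_integrable hz μ).aestronglyMeasurable
  · filter_upwards [Ioo_mem_nhds (show ν - 1 < ν by linarith) (show ν < ν + 1 by linarith)] with μ hμ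
    refine Eventually.of_forall fun t => ?_
    have hp : 0 < gj z μ t := by unfold gj; positivity
    rw [Real.norm_eq_abs, abs_of_pos hp]
    unfold gj
    rw [← add_mul]
    gcongr
    rcases le_total 0 t with ht | ht
    · have : Real.exp (μ * t) ≤ Real.exp ((ν + 1) * t) :=
        Real.exp_le_exp.mpr (mul_le_mul_of_nonneg_right hμ.2.le ht)
      linarith [Real.exp_pos ((ν - 1) * t)]
    · have : Real.exp (μ * t) ≤ Real.exp ((ν - 1) * t) :=
        Real.exp_le_exp.mpr (mul_le_mul_of_nonpos_right hμ.1.le ht)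
      linarith [Real.exp_pos ((ν + 1) * t)]
  · exact (gj_integrable hz _).add (gj_integrable hz _)
  · refine Eventually.of_forall fun t => ?_
    unfold gj
    fun_prop

lemma NI_neBot (ν : ℝ) : (nhdsWithin ν {μ : ℝ | ∀ n : ℤ, μ ≠ (n : ℝ)}).NeBot := by
  have hc : (Set.range ((↑) : ℤ → ℝ)).Countable := Set.countable_range _
  have hd := hc.dense_compl ℝ
  have he : {μ : ℝ | ∀ n : ℤ, μ ≠ (n : ℝ)} = (Set.range ((↑) : ℤ → ℝ))ᶜ := by
    ext μ
    simp [eq_comm]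
  rw [he]
  exact mem_closure_iff_nhdsWithin_neBot.mp (hd ν)

theorem stmt12 (ν : ℝ) (hν : 0 ≤ ν) (z : ℝ) (hz : 0 < z) :
    besselK ν (2 * z)
      = ∫ t in Set.Ioi (0 : ℝ),
          Real.exp (-z * Real.exp t) * Real.exp (-z * Real.exp (-t)) * Real.cosh (ν * t) := by
  have hb := NI_neBot ν
  unfold besselK
  apply Filter.Tendsto.limUnder_eq
  rw [gj_fold hz]
  have hc : Tendsto (fun μ => (1 / 2) * ∫ t, gj z μ t) (nhdsWithin ν {μ : ℝ | ∀ n : ℤ, μ ≠ (n : ℝ)})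
      (nhds ((1 / 2) * ∫ t, gj z ν t)) :=
    ((gj_cont hz ν).tendsto.const_mul _).mono_left nhdsWithin_le_nhds
  refine hc.congr' ?_
  filter_upwards [self_mem_nhdsWithin] with μ hμ
  have h0 := bD_all (ν := μ) hμ (y := z ^ 2) (by positivity)
  rw [bD, sub_eq_zero] at h0
  rw [gj_integral hz, h0, bR, besselI_eq _ hz, besselI_eq _ hz]
  have h1 : z ^ μ = z ^ (-μ) * (z ^ 2) ^ μ := by
    rw [← Real.rpow_natCast, ← Real.rpow_mul hz.le, ← Real.rpow_add hz]
    congr 1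
    push_cast
    ring
  rw [h1, mul_comm Real.pi μ, mul_comm (2:ℝ), ← div_div]
  ring
end
end
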